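/- Let D be a weighted oriented graph having at most two unbalanced cycles such that (i) if D has exactly two unbalanced cycles connected by a path P, then no balanced cycle in D shares an edge with P, and (ii) no two balanced cycles in D share a path. Then any two distinct elements of the Graver basis Gr_D have disjoint supports. -/

import Mathlib

open MvPolynomial Finset

/-- The "positive part" `∏ e, X e ^ (b e)⁺` of the binomial associated to an
integer vector `b`. -/
noncomputable def binomPlus (K : Type*) [Field K] {ι : Type*} [Fintype ι]
    (b : ι → ℤ) : MvPolynomial ι K :=
  ∏ e, X e ^ (b e).toNat

/-- The "negative part" `∏ e, X e ^ (b e)⁻` of the binomial associated to an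
integer vector `b`. -/
noncomputable def binomMinus (K : Type*) [Field K] {ι : Type*} [Fintype ι]
    (b : ι → ℤ) : MvPolynomial ι K :=
  ∏ e, X e ^ (-b e).toNat

/-- The (pure) binomial `f_b = f_b⁺ - f_b⁻` associated to an integer vector `b`. -/
noncomputable def binom (K : Type*) [Field K] {ι : Type*} [Fintype ι]
    (b : ι → ℤ) : MvPolynomial ι K :=
  binomPlus K b - binomMinus K b

/-- Support of an integer vector. -/
def vsupp {ι : Type*} (b : ι → ℤ) : Set ι := {e | b e ≠ 0}

/-- `f_b` is a primitive binomial of the ideal `I`. -/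
def IsPrimitiveIn (K : Type*) [Field K] {ι : Type*} [Fintype ι]
    (I : Ideal (MvPolynomial ι K)) (b : ι → ℤ) : Prop :=
  b ≠ 0 ∧ binom K b ∈ I ∧
    ∀ c : ι → ℤ, c ≠ 0 → binom K c ∈ I →
      binomPlus K c ∣ binomPlus K b → binomMinus K c ∣ binomMinus K b → c = b

/-- A (vertex-)weighted oriented graph: finite sets of vertices and edges, each
edge `e` oriented from `src e` to `tgt e`, no loops, no parallel edges, and a
positive integer weight attached to every vertex. -/
structure WOGraph (V E : Type*) where
  src : E → V
  tgt : E → V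
  w : V → ℕ
  no_loop : ∀ e, src e ≠ tgt e
  no_parallel : ∀ e e' : E, s(src e, tgt e) = s(src e', tgt e') → e = e'
  wpos : ∀ v, 0 < w v

namespace WOGraph

variable {V E : Type*}

/-- The toric ideal `I_D` of a weighted oriented graph: the kernel of
`K[e : e ∈ E(D)] → K[x : x ∈ V(D)]`, `e = (x_i,x_j) ↦ x_i x_j ^ w_j`. -/
noncomputable def toricIdeal (D : WOGraph V E) (K : Type*) [Field K] :
    Ideal (MvPolynomial E K) :=
  RingHom.ker (aeval (R := K)
    (fun e => X (D.src e) * X (D.tgt e) ^ D.w (D.tgt e)) :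
      MvPolynomial E K →ₐ[K] MvPolynomial V K).toRingHom

/-- The edge `e` is incident with the vertex `v`. -/
def incident (D : WOGraph V E) (v : V) (e : E) : Prop :=
  D.src e = v ∨ D.tgt e = v

/-- Degree of a vertex. -/
noncomputable def degree (D : WOGraph V E) (v : V) : ℕ :=
  Set.ncard {e : E | D.incident v e}

/-- A leaf is a vertex of degree 1. -/
def IsLeaf (D : WOGraph V E) (v : V) : Prop := D.degree v = 1

/-- A sink is a vertex of outdegree 0. -/
def IsSink (D : WOGraph V E) (v : V) : Prop := ∀ e, D.src e ≠ v

/-- The Graver basis `Gr_D`: the set of primitive binomials of `I_D`. -/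
def graverSet (D : WOGraph V E) (K : Type*) [Field K] [Fintype E] :
    Set (MvPolynomial E K) :=
  {f | ∃ b : E → ℤ, f = binom K b ∧ IsPrimitiveIn K (D.toricIdeal K) b}

/-- The set `C_D` of circuits of `I_D`: irreducible binomials of `I_D` with
minimal support. -/
def circuitSet (D : WOGraph V E) (K : Type*) [Field K] [Fintype E] :
    Set (MvPolynomial E K) :=
  {f | ∃ b : E → ℤ, f = binom K b ∧ b ≠ 0 ∧ binom K b ∈ D.toricIdeal K ∧
      (Finset.univ.gcd fun e => (b e).natAbs) = 1 ∧
      ∀ c : E → ℤ, c ≠ 0 → binom K c ∈ D.toricIdeal K →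
        vsupp c ⊆ vsupp b → vsupp c = vsupp b}

/-- Cyclic successor on `Fin n`. -/
def finRot {n : ℕ} (i : Fin n) : Fin n := ⟨((i : ℕ) + 1) % n, Nat.mod_lt _ i.pos⟩

/-- A cycle of length `n ≥ 3` in a weighted oriented graph `D`, with its usual
labelling: the edge `edge i` joins the vertices `vert i` and `vert (i+1)`
(indices cyclically). -/
structure CycleIn (D : WOGraph V E) where
  n : ℕ
  hn : 3 ≤ n
  vert : Fin n → V
  edge : Fin n → E
  vinj : Function.Injective vert
  einj : Function.Injective edge
  hinc : ∀ i : Fin n, s(D.src (edge i), D.tgt (edge i)) = s(vert i, vert (finRot i))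

/-- A path of length `k ≥ 1` in `D`, with its usual labelling: the edge `edge i`
joins `vert i` and `vert (i+1)`. -/
structure PathIn (D : WOGraph V E) where
  k : ℕ
  hk : 1 ≤ k
  vert : Fin (k + 1) → V
  edge : Fin k → E
  vinj : Function.Injective vert
  einj : Function.Injective edge
  hinc : ∀ i : Fin k, s(D.src (edge i), D.tgt (edge i)) = s(vert i.castSucc, vert i.succ)

variable [DecidableEq V]

/-- The incidence entry of a vertex `v` and an edge `e`: `1` if `e` leaves `v`,
`w v` if `e` enters `v`, `0` otherwise. -/
def inc (D : WOGraph V E) (v : V) (e : E) : ℤ :=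
  if D.src e = v then 1 else if D.tgt e = v then (D.w v : ℤ) else 0

/-- The incidence matrix of a cycle in `D` (with respect to its usual labelling). -/
def CycleIn.mat {D : WOGraph V E} (C : CycleIn D) : Matrix (Fin C.n) (Fin C.n) ℤ :=
  fun i j => D.inc (C.vert i) (C.edge j)

/-- A cycle is balanced if its incidence matrix is singular. -/
def CycleIn.IsBalanced {D : WOGraph V E} (C : CycleIn D) : Prop := C.mat.det = 0

/-- A cycle is unbalanced if its incidence matrix is nonsingular. -/
def CycleIn.IsUnbalanced {D : WOGraph V E} (C : CycleIn D) : Prop := C.mat.det ≠ 0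

end WOGraph

namespace WOGraph

variable {V E : Type*}

/-- Two cycles share exactly one vertex. -/
def ShareOneVertex {D : WOGraph V E} (C₁ C₂ : CycleIn D) : Prop :=
  (∃ v : V, Set.range C₁.vert ∩ Set.range C₂.vert = {v}) ∧
    Set.range C₁.edge ∩ Set.range C₂.edge = ∅

/-- Two cycles share the path `P`. -/
def SharePath {D : WOGraph V E} (C₁ C₂ : CycleIn D) (P : PathIn D) : Prop :=
  Set.range P.edge ⊆ Set.range C₁.edge ∧ Set.range P.edge ⊆ Set.range C₂.edge ∧
    Set.range C₁.edge ∩ Set.range C₂.edge = Set.range P.edge ∧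
    Set.range C₁.vert ∩ Set.range C₂.vert = Set.range P.vert

/-- Two (disjoint) cycles are connected by the path `P`, which meets `C₁` only in
its first vertex and `C₂` only in its last vertex. -/
def ConnectedByPath {D : WOGraph V E} (C₁ C₂ : CycleIn D) (P : PathIn D) : Prop :=
  Set.range C₁.vert ∩ Set.range C₂.vert = ∅ ∧
    P.vert 0 ∈ Set.range C₁.vert ∧ P.vert (Fin.last P.k) ∈ Set.range C₂.vert ∧
    (∀ i : Fin (P.k + 1), i ≠ 0 → P.vert i ∉ Set.range C₁.vert) ∧
    (∀ i : Fin (P.k + 1), i ≠ Fin.last P.k → P.vert i ∉ Set.range C₂.vert) ∧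
    Set.range P.edge ∩ (Set.range C₁.edge ∪ Set.range C₂.edge) = ∅

/-- `f` is the primitive binomial generator of the (principal) toric ideal of the
subgraph of `D` with edge set `S` (identified with the binomials of `I_D`
supported in `S`). -/
def IsPrimGenOn (D : WOGraph V E) (K : Type*) [Field K] [Fintype E]
    (S : Set E) (f : MvPolynomial E K) : Prop :=
  ∃ b : E → ℤ, f = binom K b ∧ b ≠ 0 ∧ vsupp b ⊆ S ∧ binom K b ∈ D.toricIdeal K ∧
    (∀ c : E → ℤ, c ≠ 0 → vsupp c ⊆ S → binom K c ∈ D.toricIdeal K →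
      binomPlus K c ∣ binomPlus K b → binomMinus K c ∣ binomMinus K b → c = b) ∧
    (∀ g : MvPolynomial E K, g ∈ D.toricIdeal K →
      (∀ m ∈ g.support, ∀ e : E, m e ≠ 0 → e ∈ S) → g ∈ Ideal.span {f})

end WOGraph

namespace WOGraph

variable {V E : Type*}

/-- The unordered pair of end vertices of an edge. -/
def ends (D : WOGraph V E) (e : E) : Sym2 V := s(D.src e, D.tgt e)

theorem ends_injective (D : WOGraph V E) : Function.Injective D.ends :=
  fun e e' h => D.no_parallel e e' h

theorem ends_ne (D : WOGraph V E) (e : E) (v : V) : D.ends e ≠ s(v, v) := by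
  intro h
  apply D.no_loop e
  simp only [ends, Sym2.eq_iff] at h
  rcases h with h | h <;> exact h.1.trans h.2.symm

section Lattice

variable [DecidableEq V]

theorem inc_eq_zero (D : WOGraph V E) {v : V} {e : E} (h : v ∉ D.ends e) : D.inc v e = 0 := by
  simp only [ends, Sym2.mem_iff, not_or] at h
  simp [inc, Ne.symm h.1, Ne.symm h.2]

theorem inc_ne_zero (D : WOGraph V E) {v : V} {e : E} (h : v ∈ D.ends e) : D.inc v e ≠ 0 := by
  have := D.wpos v
  simp only [ends, Sym2.mem_iff] at h
  unfold inc
  split_ifs with h1 h2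
  · simp
  · simp; omega
  · rcases h with h | h
    · exact absurd h.symm h1
    · exact absurd h.symm h2

variable [Fintype E]

/-- The integer kernel of the incidence matrix. -/
def kerLattice (D : WOGraph V E) : Submodule ℤ (E → ℤ) :=
  LinearMap.ker (Matrix.of D.inc).mulVecLin

theorem mem_kerLattice {D : WOGraph V E} {b : E → ℤ} :
    b ∈ D.kerLattice ↔ ∀ v, ∑ e, D.inc v e * b e = 0 := by
  rw [kerLattice, LinearMap.mem_ker]
  exact funext_iff

theorem mem_kerLattice_of_smul {D : WOGraph V E} {b : E → ℤ} {a : ℤ} (ha : a ≠ 0)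
    (h : a • b ∈ D.kerLattice) : b ∈ D.kerLattice := by
  rw [kerLattice, LinearMap.mem_ker, map_smul] at h
  exact (smul_eq_zero.1 h).resolve_left ha

/-- The exponent vector of the monomial to which an edge is sent. -/
noncomputable def edgeExp (D : WOGraph V E) (e : E) : V →₀ ℕ :=
  Finsupp.single (D.src e) 1 + Finsupp.single (D.tgt e) (D.w (D.tgt e))

omit [Fintype E] in
theorem edgeExp_apply (D : WOGraph V E) (v : V) (e : E) : (D.edgeExp e v : ℤ) = D.inc v e := by
  have := D.no_loop e
  unfold edgeExp inc
  by_cases h : D.src e = v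
  · subst h
    simp [this.symm]
  · by_cases h' : D.tgt e = v
    · subst h'
      simp [this]
    · simp [h, h']

omit [DecidableEq V] in
theorem aeval_prod_X_pow (D : WOGraph V E) (K : Type*) [Field K] (n : E → ℕ) :
    aeval (R := K) (fun e => (X (D.src e) * X (D.tgt e) ^ D.w (D.tgt e) : MvPolynomial V K))
      (∏ e, X e ^ n e) = monomial (∑ e, n e • D.edgeExp e) 1 := by
  rw [map_prod, monomial_sum_one]
  refine Finset.prod_congr rfl fun e _ => ?_
  rw [map_pow, aeval_X, ← one_pow (n e), ← monomial_pow, edgeExp, X_pow_eq_monomial, X,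
    monomial_mul, one_mul]

theorem binom_mem_toricIdeal (D : WOGraph V E) (K : Type*) [Field K] (b : E → ℤ) :
    binom K b ∈ D.toricIdeal K ↔ b ∈ D.kerLattice := by
  have h : binom K b ∈ D.toricIdeal K ↔
      ∑ e, (b e).toNat • D.edgeExp e = ∑ e, (-b e).toNat • D.edgeExp e := by
    rw [toricIdeal, RingHom.mem_ker]
    change aeval _ _ = _ ↔ _
    rw [binom, map_sub, binomPlus, binomMinus, aeval_prod_X_pow, aeval_prod_X_pow, sub_eq_zero,
      monomial_left_inj one_ne_zero]
  rw [h, mem_kerLattice, Finsupp.ext_iff]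
  refine forall_congr' fun v => ?_
  rw [← Int.natCast_inj, ← sub_eq_zero]
  simp only [Finsupp.finsetSum_apply, Finsupp.smul_apply, smul_eq_mul, Nat.cast_sum, Nat.cast_mul,
    edgeExp_apply, ← Finset.sum_sub_distrib]
  refine Eq.congr_left (Finset.sum_congr rfl fun e _ => ?_)
  rw [← sub_mul, Int.toNat_sub_toNat_neg, mul_comm]

end Lattice

end WOGraph

theorem vars_binom_subset (K : Type*) [Field K] {ι : Type*} [Fintype ι] (b : ι → ℤ) {i : ι}
    (hi : i ∈ (binom K b).vars) : b i ≠ 0 := by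
  classical
  intro h0
  have key : ∀ n : ι → ℕ, n i = 0 → i ∉ (∏ e, X e ^ n e : MvPolynomial ι K).vars := by
    intro n hn hmem
    obtain ⟨e, -, he⟩ := Finset.mem_biUnion.1 (vars_prod _ hmem)
    by_cases hie : e = i
    · subst hie
      simp [hn] at he
    · have := vars_pow _ _ he
      rw [vars_X, Finset.mem_singleton] at this
      exact hie this.symm
  rcases Finset.mem_union.1 (vars_sub_subset _ hi) with h | h
  · exact key _ (by simp [h0]) h
  · exact key _ (by simp [h0]) h

/-- A primitive vector equals every nonzero lattice vector conformal to it. -/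
theorem IsPrimitiveIn.eq_of_conformal {K : Type*} [Field K] {ι : Type*} [Fintype ι]
    {I : Ideal (MvPolynomial ι K)} {b c : ι → ℤ} (hb : IsPrimitiveIn K I b) (hc : c ≠ 0)
    (hcI : binom K c ∈ I) (h1 : ∀ i, (c i).toNat ≤ (b i).toNat)
    (h2 : ∀ i, (-c i).toNat ≤ (-b i).toNat) : c = b :=
  hb.2.2 c hc hcI (Finset.prod_dvd_prod_of_dvd _ _ fun i _ => pow_dvd_pow _ (h1 i))
    (Finset.prod_dvd_prod_of_dvd _ _ fun i _ => pow_dvd_pow _ (h2 i))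

namespace WOGraph

variable {V E : Type*} {D : WOGraph V E}

/-- An edge set is leafless if each end of each of its edges lies on another of its edges. -/
def Leafless (D : WOGraph V E) (X : Set E) : Prop :=
  ∀ x ∈ X, ∀ v ∈ D.ends x, ∃ y ∈ X, y ≠ x ∧ v ∈ D.ends y

theorem leafless_vsupp [DecidableEq V] [Fintype E] {z : E → ℤ} (hz : z ∈ D.kerLattice) :
    D.Leafless (vsupp z) := by
  intro x hx v hv
  by_contra! h
  have h1 := mem_kerLattice.1 hz v
  rw [Finset.sum_eq_single x] at h1
  · exact (mul_ne_zero (inc_ne_zero D hv) hx) h1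
  · intro y _ hyx
    by_cases hy : z y = 0
    · simp [hy]
    · rw [inc_eq_zero D (h y hy hyx), zero_mul]
  · simp

/-- A closed sequence of vertices, injective up to its repeated end, is a cycle. -/
theorem exists_cycleIn {n : ℕ} (hn : 3 ≤ n) (d : ℕ → V)
    (hinj : ∀ i < n, ∀ j < n, d i = d j → i = j) (hcl : d n = d 0)
    (hadj : ∀ i < n, ∃ e, D.ends e = s(d i, d (i + 1))) :
    ∃ C : CycleIn D, (∀ v, v ∈ Set.range C.vert ↔ ∃ i < n, d i = v) ∧
      ∀ e, e ∈ Set.range C.edge ↔ ∃ i < n, D.ends e = s(d i, d (i + 1)) := by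
  have : Nonempty E := ⟨(hadj 0 (by omega)).choose⟩
  choose! e he using hadj
  have hsucc : ∀ i < n, d (i + 1) = d ((i + 1) % n) := by
    intro i hi
    rcases Nat.lt_or_ge (i + 1) n with h | h
    · rw [Nat.mod_eq_of_lt h]
    · have : i + 1 = n := by omega
      rw [this, hcl, Nat.mod_self]
  have hmod : ∀ i, i < n → (i + 1 < n ∧ (i + 1) % n = i + 1) ∨ (i + 1 = n ∧ (i + 1) % n = 0) := by
    intro i hi
    rcases Nat.lt_or_ge (i + 1) n with h | h
    · exact Or.inl ⟨h, Nat.mod_eq_of_lt h⟩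
    · have : i + 1 = n := by omega
      exact Or.inr ⟨this, by rw [this, Nat.mod_self]⟩
  refine ⟨⟨n, hn, fun i => d i, fun i => e i, ?_, ?_, ?_⟩, ?_, ?_⟩
  · intro i j h
    exact Fin.ext (hinj i i.2 j j.2 h)
  · intro i j h
    have h' : D.ends (e i) = D.ends (e j) := congrArg _ h
    rw [he i i.2, he j j.2, Sym2.eq_iff, hsucc i i.2, hsucc j j.2] at h'
    apply Fin.ext
    have hn0 : 0 < n := by omega
    rcases h' with h' | h'
    · exact hinj i i.2 j j.2 h'.1
    · have h1 := hinj _ i.2 _ (Nat.mod_lt _ hn0) h'.1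
      have h2 := hinj _ (Nat.mod_lt _ hn0) _ j.2 h'.2
      have h3 := hmod i i.2
      have h4 := hmod j j.2
      omega
  · intro i
    change D.ends (e i) = s(d i, d (((i : ℕ) + 1) % n))
    rw [he i i.2, hsucc i i.2]
  · intro v
    constructor
    · rintro ⟨i, rfl⟩
      exact ⟨i, i.2, rfl⟩
    · rintro ⟨i, hi, rfl⟩
      exact ⟨⟨i, hi⟩, rfl⟩
  · intro x
    constructor
    · rintro ⟨i, rfl⟩
      exact ⟨i, i.2, he i i.2⟩
    · rintro ⟨i, hi, hx⟩
      exact ⟨⟨i, hi⟩, D.ends_injective ((he i hi).trans hx.symm)⟩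

/-- An injective sequence of vertices, consecutive ones adjacent, is a path. -/
theorem exists_pathIn {k : ℕ} (hk : 1 ≤ k) (p : ℕ → V)
    (hinj : ∀ i ≤ k, ∀ j ≤ k, p i = p j → i = j)
    (hadj : ∀ i < k, ∃ e, D.ends e = s(p i, p (i + 1))) :
    ∃ P : PathIn D, P.k = k ∧ (∀ i : Fin (P.k + 1), P.vert i = p i) ∧
      ∀ e, e ∈ Set.range P.edge ↔ ∃ i < k, D.ends e = s(p i, p (i + 1)) := by
  have : Nonempty E := ⟨(hadj 0 (by omega)).choose⟩
  choose! e he using hadj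
  refine ⟨⟨k, hk, fun i => p i, fun i => e i, ?_, ?_, ?_⟩, rfl, fun _ => rfl, ?_⟩
  · intro i j h
    exact Fin.ext (hinj i (Nat.le_of_lt_succ i.2) j (Nat.le_of_lt_succ j.2) h)
  · intro i j h
    have h' : D.ends (e i) = D.ends (e j) := congrArg _ h
    have hi := i.2
    have hj := j.2
    rw [he i i.2, he j j.2, Sym2.eq_iff] at h'
    apply Fin.ext
    rcases h' with h' | h'
    · exact hinj i hi.le j hj.le h'.1
    · have h1 := hinj _ hi.le _ (by omega) h'.1
      have h2 := hinj _ (by omega) _ hj.le h'.2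
      omega
  · intro i
    exact he i i.2
  · intro x
    constructor
    · rintro ⟨i, rfl⟩
      exact ⟨i, i.2, he i i.2⟩
    · rintro ⟨i, hi, hx⟩
      exact ⟨⟨i, hi⟩, D.ends_injective ((he i hi).trans hx.symm)⟩

/-- A periodic labelling of the vertices of a cycle by the natural numbers. -/
structure CycleIn.IsLabel (C : CycleIn D) (v : ℕ → V) : Prop where
  per : Function.Periodic v C.n
  inj : ∀ i j, v i = v j → i ≡ j [MOD C.n]
  mem_vert : ∀ i, v i ∈ Set.range C.vert
  exists_vert : ∀ x ∈ Set.range C.vert, ∃ i, v i = x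
  exists_edge : ∀ i, ∃ e ∈ Set.range C.edge, D.ends e = s(v i, v (i + 1))
  exists_index : ∀ e ∈ Set.range C.edge, ∃ i, D.ends e = s(v i, v (i + 1))

namespace CycleIn

theorem exists_isLabel (C : CycleIn D) : ∃ v, C.IsLabel v := by
  have hn := C.hn
  have h0 : 0 < C.n := by omega
  have hends : ∀ i : ℕ, D.ends (C.edge ⟨i % C.n, Nat.mod_lt _ h0⟩) =
      s(C.vert ⟨i % C.n, Nat.mod_lt _ h0⟩, C.vert ⟨(i + 1) % C.n, Nat.mod_lt _ h0⟩) := by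
    intro i
    have := C.hinc ⟨i % C.n, Nat.mod_lt _ h0⟩
    rw [ends, this]
    congr 3
    simp [finRot]
  refine ⟨fun i => C.vert ⟨i % C.n, Nat.mod_lt _ h0⟩, ?_, ?_, ?_, ?_, ?_, ?_⟩
  · intro i
    simp
  · intro i j h
    exact congrArg Fin.val (C.vinj h)
  · intro i
    exact ⟨_, rfl⟩
  · rintro _ ⟨i, rfl⟩
    refine ⟨i, ?_⟩
    congr 1
    exact Fin.ext (Nat.mod_eq_of_lt i.2)
  · intro i
    exact ⟨_, ⟨_, rfl⟩, hends i⟩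
  · rintro _ ⟨i, rfl⟩
    refine ⟨i, ?_⟩
    rw [← hends]
    congr 2
    exact Fin.ext (Nat.mod_eq_of_lt i.2).symm

namespace IsLabel

variable {C : CycleIn D} {v : ℕ → V}

theorem eq_iff (h : C.IsLabel v) {i j : ℕ} : v i = v j ↔ i ≡ j [MOD C.n] := by
  refine ⟨h.inj i j, fun hij => ?_⟩
  rw [← h.per.map_mod_nat i, ← h.per.map_mod_nat j, hij]

theorem eq_of_lt (h : C.IsLabel v) {i j : ℕ} (hi : i < C.n) (hj : j < C.n) (hij : v i = v j) :
    i = j :=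
  Nat.ModEq.eq_of_lt_of_lt (h.inj i j hij) hi hj

theorem succ_eq_succ (h : C.IsLabel v) {i j : ℕ} : v (i + 1) = v (j + 1) ↔ v i = v j := by
  rw [h.eq_iff, h.eq_iff]
  exact ⟨Nat.ModEq.add_right_cancel' 1, Nat.ModEq.add_right 1⟩

theorem exists_vert_lt (h : C.IsLabel v) {x : V} (hx : x ∈ Set.range C.vert) :
    ∃ i < C.n, v i = x := by
  obtain ⟨i, rfl⟩ := h.exists_vert x hx
  have := C.hn
  exact ⟨i % C.n, Nat.mod_lt _ (by omega), h.per.map_mod_nat i⟩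

theorem exists_index_lt (h : C.IsLabel v) {e : E} (he : e ∈ Set.range C.edge) :
    ∃ i < C.n, D.ends e = s(v i, v (i + 1)) := by
  obtain ⟨i, hi⟩ := h.exists_index e he
  have := C.hn
  refine ⟨i % C.n, Nat.mod_lt _ (by omega), ?_⟩
  rw [hi, h.per.map_mod_nat i, h.succ_eq_succ.2 (h.per.map_mod_nat i)]

theorem mem_edge (h : C.IsLabel v) {e : E} {i : ℕ} (he : D.ends e = s(v i, v (i + 1))) :
    e ∈ Set.range C.edge := by
  obtain ⟨x, hx, hxi⟩ := h.exists_edge i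
  rwa [← D.ends_injective (hxi.trans he.symm)]

theorem shift (h : C.IsLabel v) (t : ℕ) : C.IsLabel (fun i => v (i + t)) where
  per i := by
    have := h.per (i + t)
    rwa [show i + t + C.n = i + C.n + t by omega] at this
  inj i j hij := Nat.ModEq.add_right_cancel' t (h.inj _ _ hij)
  mem_vert i := h.mem_vert _
  exists_vert x hx := by
    obtain ⟨i, rfl⟩ := h.exists_vert x hx
    have h0 := C.hn
    refine ⟨i + t * (C.n - 1), ?_⟩
    rw [h.eq_iff]
    have : i + t * (C.n - 1) + t = i + t * C.n := by
      obtain ⟨m, hm⟩ : ∃ m, C.n = m + 1 := ⟨C.n - 1, by omega⟩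
      rw [hm, Nat.add_sub_cancel]; ring
    rw [this]
    simp [Nat.ModEq]
  exists_edge i := by
    have := h.exists_edge (i + t)
    rwa [show i + t + 1 = i + 1 + t by omega] at this
  exists_index e he := by
    obtain ⟨i, hi⟩ := h.exists_index e he
    have h0 := C.hn
    have h1 : v (i + t * (C.n - 1) + t) = v i := by
      rw [h.eq_iff]
      have : i + t * (C.n - 1) + t = i + t * C.n := by
        obtain ⟨m, hm⟩ : ∃ m, C.n = m + 1 := ⟨C.n - 1, by omega⟩
        rw [hm, Nat.add_sub_cancel]; ring
      rw [this]
      simp [Nat.ModEq]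
    refine ⟨i + t * (C.n - 1), ?_⟩
    rw [hi, h1, ← h.succ_eq_succ.2 h1, Nat.add_right_comm _ 1 t]

theorem ends_of_mem (h : C.IsLabel v) {y : E} (hy : y ∈ Set.range C.edge) {i : ℕ}
    (hi : v (i + 1) ∈ D.ends y) :
    D.ends y = s(v i, v (i + 1)) ∨ D.ends y = s(v (i + 1), v (i + 1 + 1)) := by
  obtain ⟨j, hj⟩ := h.exists_index y hy
  rw [hj, Sym2.mem_iff] at hi
  rcases hi with hi | hi
  · right
    rw [hj, ← hi, h.succ_eq_succ.2 hi]
  · left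
    rw [hj, ← hi, h.succ_eq_succ.1 hi]

theorem exists_next (h : C.IsLabel v) {X : Set E} (hX : D.Leafless X) {i : ℕ} {e : E} (heX : e ∈ X)
    (he : D.ends e = s(v i, v (i + 1)))
    (hC : ∀ y ∈ X, v (i + 1) ∈ D.ends y → y ∈ Set.range C.edge) :
    ∃ y ∈ X, D.ends y = s(v (i + 1), v (i + 1 + 1)) := by
  obtain ⟨y, hyX, hye, hy⟩ := hX e heX (v (i + 1)) (by simp [he])
  refine ⟨y, hyX, ?_⟩
  rcases h.ends_of_mem (hC y hyX hy) hy with h1 | h1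
  · exact absurd (D.ends_injective (h1.trans he.symm)) hye
  · exact h1

theorem exists_prev (h : C.IsLabel v) {X : Set E} (hX : D.Leafless X) {i : ℕ} {e : E} (heX : e ∈ X)
    (he : D.ends e = s(v (i + 1), v (i + 1 + 1)))
    (hC : ∀ y ∈ X, v (i + 1) ∈ D.ends y → y ∈ Set.range C.edge) :
    ∃ y ∈ X, D.ends y = s(v i, v (i + 1)) := by
  obtain ⟨y, hyX, hye, hy⟩ := hX e heX (v (i + 1)) (by simp [he])
  refine ⟨y, hyX, ?_⟩
  rcases h.ends_of_mem (hC y hyX hy) hy with h1 | h1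
  · exact h1
  · exact absurd (D.ends_injective (h1.trans he.symm)) hye

end IsLabel

theorem mem_vert_of_mem_ends (C : CycleIn D) {e : E} (he : e ∈ Set.range C.edge) {x : V}
    (hx : x ∈ D.ends e) : x ∈ Set.range C.vert := by
  obtain ⟨v, h⟩ := C.exists_isLabel
  obtain ⟨i, hi⟩ := h.exists_index e he
  rw [hi, Sym2.mem_iff] at hx
  rcases hx with rfl | rfl <;> exact h.mem_vert _

theorem edge_nonempty (C : CycleIn D) : (Set.range C.edge).Nonempty := by
  have := C.hn
  exact ⟨_, ⟨0, by omega⟩, rfl⟩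

theorem leafless (C : CycleIn D) : D.Leafless (Set.range C.edge) := by
  intro e he x hx
  obtain ⟨v, h⟩ := C.exists_isLabel
  have hn := C.hn
  obtain ⟨i, rfl⟩ := h.exists_vert x (C.mem_vert_of_mem_ends he hx)
  obtain ⟨y, hy, hyi⟩ := h.exists_edge i
  have hprev : v (i + (C.n - 1) + 1) = v i := by
    rw [show i + (C.n - 1) + 1 = i + C.n by omega]
    exact h.per i
  obtain ⟨y', hy', hyi'⟩ := h.exists_edge (i + (C.n - 1))
  by_cases hye : y = e
  · refine ⟨y', hy', ?_, by simp [hyi', hprev]⟩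
    rintro rfl
    rw [← hye, hyi, Sym2.eq_iff] at hyi'
    have key : ∀ a b, v a = v (i + b) → a ≡ i + b [MOD C.n] := fun a b => h.inj _ _
    rcases hyi' with h1 | h1
    · have := key i _ h1.1
      rw [← Nat.add_zero i, Nat.add_assoc] at this
      have := (Nat.ModEq.add_left_cancel' i this).eq_of_lt_of_lt (by omega) (by omega)
      omega
    · have := key _ _ h1.2
      have := (Nat.ModEq.add_left_cancel' i this).eq_of_lt_of_lt (by omega) (by omega)
      omega
  · exact ⟨y, hy, hye, by simp [hyi]⟩

theorem edge_subset_of_leafless (C : CycleIn D) {X : Set E} (hX : D.Leafless X)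
    (hXC : X ⊆ Set.range C.edge) (hne : X.Nonempty) : Set.range C.edge ⊆ X := by
  obtain ⟨v, h⟩ := C.exists_isLabel
  obtain ⟨x, hx⟩ := hne
  obtain ⟨i, hi⟩ := h.exists_index x (hXC hx)
  have key : ∀ j, ∃ y ∈ X, D.ends y = s(v (i + j), v (i + j + 1)) := by
    intro j
    induction j with
    | zero => exact ⟨x, hx, hi⟩
    | succ j ih =>
      obtain ⟨y, hy, hyj⟩ := ih
      exact h.exists_next hX hy hyj fun y hy _ => hXC hy
  intro e he
  obtain ⟨j, hj⟩ := h.exists_index e he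
  have hn := C.hn
  obtain ⟨y, hy, hyj⟩ := key (j + i * (C.n - 1))
  have h1 : v (i + (j + i * (C.n - 1))) = v j := by
    rw [h.eq_iff]
    have : i + (j + i * (C.n - 1)) = j + i * C.n := by
      obtain ⟨m, hm⟩ : ∃ m, C.n = m + 1 := ⟨C.n - 1, by omega⟩
      rw [hm, Nat.add_sub_cancel]; ring
    rw [this]
    simp [Nat.ModEq]
  rw [h.succ_eq_succ.2 h1, h1] at hyj
  rwa [D.ends_injective (hj.trans hyj.symm)]

end CycleIn

end WOGraph

namespace WOGraph

variable {V E : Type*} {D : WOGraph V E}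

section Balanced

variable [DecidableEq V] [Fintype E]

namespace CycleIn

omit [DecidableEq V] in
theorem sum_mul_eq (C : CycleIn D) {z : E → ℤ} (hz : vsupp z ⊆ Set.range C.edge) (F : E → ℤ) :
    ∑ e, F e * z e = ∑ j, F (C.edge j) * z (C.edge j) := by
  refine (Finset.sum_of_injOn C.edge C.einj.injOn (fun _ _ => Finset.mem_coe.2 (Finset.mem_univ _))
    (fun e _ he => ?_) fun _ _ => rfl).symm
  have : z e = 0 := by
    by_contra h
    obtain ⟨i, rfl⟩ := hz h
    exact he ⟨i, Finset.mem_coe.2 (Finset.mem_univ _), rfl⟩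
  rw [this, mul_zero]

theorem isBalanced_iff (C : CycleIn D) :
    C.IsBalanced ↔ ∃ z ∈ D.kerLattice, z ≠ 0 ∧ vsupp z ⊆ Set.range C.edge := by
  rw [IsBalanced, ← Matrix.exists_mulVec_eq_zero_iff]
  constructor
  · rintro ⟨y, hy0, hy⟩
    have hsupp : vsupp (Function.extend C.edge y 0) ⊆ Set.range C.edge := by
      intro e he
      by_contra h
      exact he (Function.extend_apply' _ _ _ h)
    refine ⟨Function.extend C.edge y 0, ?_, ?_, hsupp⟩
    · rw [mem_kerLattice]
      intro u
      rw [C.sum_mul_eq hsupp]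
      simp only [C.einj.extend_apply]
      by_cases hu : u ∈ Set.range C.vert
      · obtain ⟨i, rfl⟩ := hu
        exact congrFun hy i
      · refine Finset.sum_eq_zero fun j _ => ?_
        rw [inc_eq_zero, zero_mul]
        exact fun h => hu (C.mem_vert_of_mem_ends ⟨j, rfl⟩ h)
    · obtain ⟨i, hi⟩ := Function.ne_iff.1 hy0
      exact Function.ne_iff.2 ⟨C.edge i, by simpa [C.einj.extend_apply] using hi⟩
  · rintro ⟨z, hz, hz0, hsupp⟩
    refine ⟨fun i => z (C.edge i), ?_, ?_⟩
    · obtain ⟨e, he⟩ := Function.ne_iff.1 hz0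
      obtain ⟨i, rfl⟩ := hsupp he
      exact Function.ne_iff.2 ⟨i, he⟩
    · funext i
      have := mem_kerLattice.1 hz (C.vert i)
      rwa [C.sum_mul_eq hsupp] at this

theorem IsBalanced.exists_vsupp_eq {C : CycleIn D} (hC : C.IsBalanced) :
    ∃ z ∈ D.kerLattice, vsupp z = Set.range C.edge := by
  obtain ⟨z, hz, hz0, hsupp⟩ := C.isBalanced_iff.1 hC
  exact ⟨z, hz, hsupp.antisymm
    (C.edge_subset_of_leafless (leafless_vsupp hz) hsupp (Function.ne_iff.1 hz0))⟩

end CycleIn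

end Balanced

section LongestPath

/-- `p 0, …, p k` is a path in the edge set `X` whose edge at index `s` is `e`. -/
structure IsPathThrough (D : WOGraph V E) (X : Set E) (e : E) (k : ℕ) (p : ℕ → V) (s : ℕ) :
    Prop where
  inj : ∀ i ≤ k, ∀ j ≤ k, p i = p j → i = j
  adj : ∀ i < k, ∃ x ∈ X, D.ends x = s(p i, p (i + 1))
  lt : s < k
  ends_eq : D.ends e = s(p s, p (s + 1))

namespace IsPathThrough

variable {X : Set E} {e : E} {k s : ℕ} {p : ℕ → V}

theorem reverse (h : D.IsPathThrough X e k p s) :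
    D.IsPathThrough X e k (fun i => p (k - i)) (k - 1 - s) where
  inj i hi j hj hij := by
    have := h.inj _ (Nat.sub_le k i) _ (Nat.sub_le k j) hij
    omega
  adj i hi := by
    obtain ⟨x, hx, hxe⟩ := h.adj (k - (i + 1)) (by omega)
    refine ⟨x, hx, ?_⟩
    rw [hxe, Sym2.eq_swap, show k - (i + 1) + 1 = k - i by omega]
  lt := by have := h.lt; omega
  ends_eq := by
    have := h.lt
    rw [h.ends_eq, Sym2.eq_swap, show k - (k - 1 - s) = s + 1 by omega,
      show k - (k - 1 - s + 1) = s by omega]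

theorem card_le [Finite V] (h : D.IsPathThrough X e k p s) : k ≤ Nat.card V := by
  have hinj : Function.Injective fun i : Fin k => p i := fun i j hij =>
    Fin.ext (h.inj i i.2.le j j.2.le hij)
  simpa using Nat.card_le_card_of_injective _ hinj

/-- The last vertex of a longest path is joined to an earlier vertex. -/
theorem exists_back_edge (h : D.IsPathThrough X e k p s) (hX : D.Leafless X)
    (hmax : ∀ k' p' s', D.IsPathThrough X e k' p' s' → k' ≤ k) :
    ∃ i, i + 2 ≤ k ∧ ∃ y ∈ X, D.ends y = s(p k, p i) := by
  have hlt := h.lt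
  obtain ⟨x, hx, hxe⟩ := h.adj (k - 1) (by omega)
  rw [show k - 1 + 1 = k by omega] at hxe
  obtain ⟨y, hy, hyx, hky⟩ := hX x hx (p k) (by simp [hxe])
  obtain ⟨u, hu⟩ := Sym2.mem_iff_exists.1 hky
  by_cases hup : ∃ i ≤ k, p i = u
  · obtain ⟨i, hi, rfl⟩ := hup
    refine ⟨i, ?_, y, hy, hu⟩
    have h1 : i ≠ k := by
      rintro rfl
      exact D.ends_ne _ _ hu
    have h2 : i ≠ k - 1 := by
      rintro rfl
      exact hyx (D.ends_injective (hu.trans (Sym2.eq_swap.trans hxe.symm)))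
    omega
  · exfalso
    push Not at hup
    have hq : ∀ i ≤ k, (if i ≤ k then p i else u) = p i := fun i hi => if_pos hi
    have hq' : (if k + 1 ≤ k then p (k + 1) else u) = u := if_neg (by omega)
    have := hmax (k + 1) (fun i => if i ≤ k then p i else u) s ⟨?_, ?_, by omega, ?_⟩
    · omega
    · intro i hi j hj hij
      rcases Nat.lt_or_ge k i with h1 | h1 <;> rcases Nat.lt_or_ge k j with h2 | h2
      · omega
      · obtain rfl : i = k + 1 := by omega
        simp only [hq j h2, hq'] at hij
        exact absurd hij.symm (hup j h2)
      · obtain rfl : j = k + 1 := by omega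
        simp only [hq i h1, hq'] at hij
        exact absurd hij (hup i h1)
      · simp only [hq i h1, hq j h2] at hij
        exact h.inj i h1 j h2 hij
    · intro i hi
      rcases Nat.lt_or_ge i k with h1 | h1
      · simp only [hq i h1.le, hq (i + 1) h1]
        exact h.adj i h1
      · obtain rfl : i = k := by omega
        simp only [hq i le_rfl, hq']
        exact ⟨y, hy, hu⟩
    · simp only [hq s hlt.le, hq (s + 1) hlt]
      exact h.ends_eq

theorem exists_cycleIn (h : D.IsPathThrough X e k p s) {a b : ℕ} (hab : a + 2 ≤ b) (hbk : b ≤ k)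
    {y : E} (hy : y ∈ X) (hye : D.ends y = s(p b, p a)) :
    ∃ C : CycleIn D, Set.range C.edge ⊆ X ∧
      (∀ u, u ∈ Set.range C.vert ↔ ∃ t, a ≤ t ∧ t ≤ b ∧ p t = u) ∧
      ∀ x t, a ≤ t → t < b → D.ends x = s(p t, p (t + 1)) → x ∈ Set.range C.edge := by
  have hd : ∀ i, i ≤ b - a → (if i ≤ b - a then p (a + i) else p a) = p (a + i) :=
    fun i hi => if_pos hi
  have hd' : (if b - a + 1 ≤ b - a then p (a + (b - a + 1)) else p a) = p a := if_neg (by omega)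
  have hadj : ∀ i < b - a + 1, ∃ x ∈ X, D.ends x = s((if i ≤ b - a then p (a + i) else p a),
      (if i + 1 ≤ b - a then p (a + (i + 1)) else p a)) := by
    intro i hi
    rcases Nat.lt_or_ge i (b - a) with h1 | h1
    · rw [hd i h1.le, hd (i + 1) h1]
      exact h.adj (a + i) (by omega)
    · obtain rfl : i = b - a := by omega
      rw [hd _ le_rfl, hd', show a + (b - a) = b by omega]
      exact ⟨y, hy, hye⟩
  obtain ⟨C, hv, he⟩ := WOGraph.exists_cycleIn (D := D) (n := b - a + 1) (by omega)
    (fun i => if i ≤ b - a then p (a + i) else p a) (fun i hi j hj hij => by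
      simp only [hd i (by omega), hd j (by omega)] at hij
      have := h.inj _ (by omega) _ (by omega) hij
      omega) (by simp) fun i hi => (hadj i hi).imp fun _ hx => hx.2
  refine ⟨C, fun x hx => ?_, fun u => ?_, fun x t h1 h2 hx => ?_⟩
  · obtain ⟨i, hi, hxi⟩ := (he x).1 hx
    obtain ⟨x', hx', hxi'⟩ := hadj i hi
    rwa [D.ends_injective (hxi.trans hxi'.symm)]
  · rw [hv]
    constructor
    · rintro ⟨i, hi, hiu⟩
      refine ⟨a + i, by omega, by omega, ?_⟩
      rwa [hd i (by omega)] at hiu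
    · rintro ⟨t, h1, h2, rfl⟩
      refine ⟨t - a, by omega, ?_⟩
      rw [hd _ (by omega), show a + (t - a) = t by omega]
  · rw [he]
    refine ⟨t - a, by omega, ?_⟩
    rw [hd _ (by omega), hd _ (by omega), hx, show a + (t - a) = t by omega,
      show a + (t - a + 1) = t + 1 by omega]

end IsPathThrough

/-- An edge of a leafless edge set lies on a cycle, or on a path connecting two disjoint
cycles. -/
theorem Leafless.exists_cycle_or_path [Finite V] {X : Set E} (hX : D.Leafless X) {e : E}
    (he : e ∈ X) :
    (∃ C : CycleIn D, Set.range C.edge ⊆ X ∧ e ∈ Set.range C.edge) ∨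
      ∃ (C₁ C₂ : CycleIn D) (P : PathIn D), Set.range C₁.edge ⊆ X ∧ Set.range C₂.edge ⊆ X ∧
        ConnectedByPath C₁ C₂ P ∧ e ∈ Set.range P.edge := by
  obtain ⟨k, ⟨p, s, h⟩, hmax⟩ : ∃ k, (∃ p s, D.IsPathThrough X e k p s) ∧
      ∀ k' p' s', D.IsPathThrough X e k' p' s' → k' ≤ k := by
    have hne : {k | ∃ p s, D.IsPathThrough X e k p s}.Nonempty := by
      refine ⟨1, fun i => if i = 0 then D.src e else D.tgt e, 0, ?_, ?_, by simp, by simp [ends]⟩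
      · intro i hi j hj hij
        have := D.no_loop e
        interval_cases i <;> interval_cases j <;> simp_all
      · intro i hi
        obtain rfl : i = 0 := by omega
        exact ⟨e, he, by simp [ends]⟩
    have hbdd : BddAbove {k | ∃ p s, D.IsPathThrough X e k p s} :=
      ⟨Nat.card V, fun k ⟨p, s, h⟩ => h.card_le⟩
    exact ⟨_, Nat.sSup_mem hne hbdd, fun k' p' s' h' => le_csSup hbdd ⟨p', s', h'⟩⟩
  have hlt := h.lt
  obtain ⟨i, hik, y, hy, hye⟩ := h.exists_back_edge hX hmax
  obtain ⟨j', hjk, y', hy', hye'⟩ := h.reverse.exists_back_edge hX hmax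
  obtain ⟨j, rfl⟩ : ∃ j, j' = k - j := ⟨k - j', by omega⟩
  replace hye' : D.ends y' = s(p (k - (k - j)), p 0) := by
    rw [hye', Nat.sub_self, Sym2.eq_swap]
  set j₁ := k - (k - j) with hj₁
  obtain ⟨C₂, hC₂, hv₂, he₂⟩ := h.exists_cycleIn hik le_rfl hy hye
  obtain ⟨C₁, hC₁, hv₁, he₁⟩ := h.exists_cycleIn (a := 0) (b := j₁) (by omega) (by omega) hy' hye'
  by_cases his : i ≤ s
  · exact Or.inl ⟨C₂, hC₂, he₂ e s his hlt h.ends_eq⟩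
  by_cases hjs : s < j₁
  · exact Or.inl ⟨C₁, hC₁, he₁ e s (Nat.zero_le _) hjs h.ends_eq⟩
  right
  obtain ⟨P, hPk, hPv, hPe⟩ := exists_pathIn (D := D) (k := i - j₁) (by omega) (fun t => p (j₁ + t))
    (fun a ha b hb hab => by
      have := h.inj _ (by omega) _ (by omega) hab
      omega)
    fun t ht => (h.adj (j₁ + t) (by omega)).imp fun _ hx => hx.2
  have hP₁ : ∀ t : Fin (P.k + 1), t ≠ 0 → P.vert t ∉ Set.range C₁.vert := by
    intro t ht
    have h1 := t.2
    have h0 : (t : ℕ) ≠ 0 := fun h => ht (Fin.ext h)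
    rw [hPv, hv₁]
    rintro ⟨t', -, h2, h3⟩
    have := h.inj _ (by omega) _ (by omega) h3
    omega
  have hP₂ : ∀ t : Fin (P.k + 1), t ≠ Fin.last P.k → P.vert t ∉ Set.range C₂.vert := by
    intro t ht
    have h1 := t.2
    have h0 : (t : ℕ) ≠ P.k := fun h => ht (Fin.ext h)
    rw [hPv, hv₂]
    rintro ⟨t', h2, h4, h3⟩
    have := h.inj _ (by omega) _ (by omega) h3
    omega
  refine ⟨C₁, C₂, P, hC₁, hC₂, ⟨?_, ?_, ?_, hP₁, hP₂, ?_⟩, ?_⟩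
  · refine Set.eq_empty_of_forall_notMem ?_
    rintro u ⟨h1, h2⟩
    obtain ⟨t, h3, h4, rfl⟩ := (hv₁ u).1 h1
    obtain ⟨t', h5, h6, h7⟩ := (hv₂ _).1 h2
    have := h.inj _ (by omega) _ (by omega) h7
    omega
  · rw [hPv, hv₁]
    exact ⟨j₁, Nat.zero_le _, le_rfl, rfl⟩
  · rw [hPv, hv₂]
    refine ⟨i, le_rfl, by omega, ?_⟩
    rw [Fin.val_last, hPk, show j₁ + (i - j₁) = i by omega]
  · refine Set.eq_empty_of_forall_notMem ?_
    rintro _ ⟨⟨t, rfl⟩, h1 | h1⟩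
    · refine hP₁ t.succ (Fin.succ_ne_zero t) (C₁.mem_vert_of_mem_ends h1 ?_)
      rw [ends, P.hinc]
      simp
    · refine hP₂ t.castSucc (Fin.castSucc_ne_last t) (C₂.mem_vert_of_mem_ends h1 ?_)
      rw [ends, P.hinc]
      simp
  · rw [hPe]
    refine ⟨s - j₁, by omega, ?_⟩
    rw [h.ends_eq, show j₁ + (s - j₁) = s by omega, show j₁ + (s - j₁ + 1) = s + 1 by omega]

end LongestPath

end WOGraph

namespace WOGraph

variable {V E : Type*} {D : WOGraph V E}

/-- `q 0, …, q k` is an ear of the cycle `C` labelled by `v`, from `v 0` to `v m`. -/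
structure IsEar (C : CycleIn D) (v : ℕ → V) (m k : ℕ) (q : ℕ → V) : Prop where
  label : C.IsLabel v
  m_pos : 0 < m
  m_lt : m < C.n
  k_pos : 0 < k
  inj : ∀ i ≤ k, ∀ j ≤ k, q i = q j → i = j
  start : q 0 = v 0
  finish : q k = v m
  notMem : ∀ i, 0 < i → i < k → q i ∉ Set.range C.vert
  adj : ∀ i < k, ∃ e ∉ Set.range C.edge, D.ends e = s(q i, q (i + 1))

namespace IsEar

variable {C : CycleIn D} {v q : ℕ → V} {m k : ℕ}

/-- The complementary arc, with the ear reversed. -/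
theorem symm (h : IsEar C v m k q) :
    IsEar C (fun i => v (i + m)) (C.n - m) k (fun i => q (k - i)) where
  label := h.label.shift m
  m_pos := by have := h.m_lt; omega
  m_lt := by have := h.m_lt; have := h.m_pos; omega
  k_pos := h.k_pos
  inj i hi j hj hij := by
    have := h.inj _ (Nat.sub_le k i) _ (Nat.sub_le k j) hij
    omega
  start := by simp [h.finish]
  finish := by
    have h1 := h.m_lt
    rw [Nat.sub_self, h.start, show C.n - m + m = 0 + C.n by omega]
    exact (h.label.per 0).symm
  notMem i hi hik := h.notMem _ (by omega) (by omega)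
  adj i hi := by
    obtain ⟨e, he, hee⟩ := h.adj (k - (i + 1)) (by omega)
    refine ⟨e, he, ?_⟩
    rw [hee, Sym2.eq_swap, show k - (i + 1) + 1 = k - i by omega]

theorem notMem_edge (h : IsEar C v m k q) {e : E} {i : ℕ} (hi : i < k)
    (he : D.ends e = s(q i, q (i + 1))) : e ∉ Set.range C.edge := by
  obtain ⟨x, hx, hxe⟩ := h.adj i hi
  rwa [← D.ends_injective (hxe.trans he.symm)]

/-- An arc of a cycle together with an ear between its end vertices is a cycle. -/
theorem exists_sharePath (h : IsEar C v m k q) :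
    ∃ (C' : CycleIn D) (A : PathIn D), SharePath C C' A ∧
      (∀ e, e ∈ Set.range A.edge ↔ ∃ i < m, D.ends e = s(v i, v (i + 1))) ∧
      ∀ e, e ∈ Set.range C'.edge ↔
        e ∈ Set.range A.edge ∨ ∃ i < k, D.ends e = s(q i, q (i + 1)) := by
  have hl := h.label
  have hm := h.m_pos
  have hmn := h.m_lt
  have hk := h.k_pos
  obtain ⟨A, hAk, hAv, hAe⟩ := exists_pathIn (D := D) h.m_pos v
    (fun i hi j hj hij => hl.eq_of_lt (by omega) (by omega) hij)
    fun i _ => (hl.exists_edge i).imp fun _ hx => hx.2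
  let d : ℕ → V := fun i => if i ≤ m then v i else q (m + k - i)
  have hd₁ : ∀ i ≤ m, d i = v i := fun i hi => if_pos hi
  have hd₂ : ∀ i, m ≤ i → d i = q (m + k - i) := by
    intro i hi
    rcases hi.eq_or_lt with rfl | hi
    · rw [hd₁ _ le_rfl, Nat.add_sub_cancel_left, h.finish]
    · exact if_neg (by omega)
  have hmk : 3 ≤ m + k := by
    by_contra hlt
    obtain rfl : m = 1 := by omega
    obtain rfl : k = 1 := by omega
    obtain ⟨e, he, hee⟩ := h.adj 0 zero_lt_one
    rw [h.start, h.finish] at hee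
    exact he (hl.mem_edge (i := 0) hee)
  have hdv : ∀ i, m < i → i < m + k → d i ∉ Set.range C.vert := by
    intro i h1 h2
    rw [hd₂ i h1.le]
    exact h.notMem _ (by omega) (by omega)
  obtain ⟨C', hv, he⟩ := exists_cycleIn (D := D) hmk d (by
    intro i hi j hj hij
    rcases Nat.lt_or_ge m i with h1 | h1 <;> rcases Nat.lt_or_ge m j with h2 | h2
    · rw [hd₂ i h1.le, hd₂ j h2.le] at hij
      have := h.inj _ (by omega) _ (by omega) hij
      omega
    · exact absurd (hij ▸ hd₁ j h2 ▸ hl.mem_vert j) (hdv i h1 hi)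
    · exact absurd (hij ▸ hd₁ i h1 ▸ hl.mem_vert i) (hdv j h2 hj)
    · rw [hd₁ i h1, hd₁ j h2] at hij
      exact hl.eq_of_lt (by omega) (by omega) hij) (by
    rw [hd₂ _ (by omega), hd₁ 0 (Nat.zero_le m), Nat.sub_self, h.start]) (by
    intro i hi
    rcases Nat.lt_or_ge i m with h1 | h1
    · rw [hd₁ i h1.le, hd₁ (i + 1) h1]
      exact (hl.exists_edge i).imp fun _ hx => hx.2
    · obtain ⟨x, -, hx⟩ := h.adj (m + k - (i + 1)) (by omega)
      rw [hd₂ i h1, hd₂ (i + 1) (by omega)]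
      refine ⟨x, ?_⟩
      rw [hx, Sym2.eq_swap, show m + k - (i + 1) + 1 = m + k - i by omega])
  have he' : ∀ e, e ∈ Set.range C'.edge ↔
      e ∈ Set.range A.edge ∨ ∃ i < k, D.ends e = s(q i, q (i + 1)) := by
    intro x
    rw [he, hAe]
    constructor
    · rintro ⟨i, hi, hx⟩
      rcases Nat.lt_or_ge i m with h1 | h1
      · rw [hd₁ i h1.le, hd₁ (i + 1) h1] at hx
        exact Or.inl ⟨i, h1, hx⟩
      · rw [hd₂ i h1, hd₂ (i + 1) (by omega)] at hx
        refine Or.inr ⟨m + k - (i + 1), by omega, ?_⟩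
        rw [hx, Sym2.eq_swap, show m + k - (i + 1) + 1 = m + k - i by omega]
    · rintro (⟨i, hi, hx⟩ | ⟨i, hi, hx⟩)
      · refine ⟨i, by omega, ?_⟩
        rw [hd₁ i hi.le, hd₁ (i + 1) hi, hx]
      · refine ⟨m + k - (i + 1), by omega, ?_⟩
        rw [hd₂ _ (by omega), hd₂ _ (by omega), hx, Sym2.eq_swap]
        congr 3 <;> omega
  have hAC : Set.range A.edge ⊆ Set.range C.edge := by
    intro x hx
    obtain ⟨i, -, hxi⟩ := (hAe x).1 hx
    exact hl.mem_edge hxi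
  refine ⟨C', A, ⟨hAC, fun x hx => (he' x).2 (Or.inl hx), ?_, ?_⟩, hAe, he'⟩
  · refine Set.Subset.antisymm ?_ fun x hx => ⟨hAC hx, (he' x).2 (Or.inl hx)⟩
    rintro x ⟨h1, h2⟩
    rcases (he' x).1 h2 with h3 | ⟨i, hi, hx⟩
    · exact h3
    · exact absurd h1 (h.notMem_edge hi hx)
  · ext u
    constructor
    · rintro ⟨h1, h2⟩
      obtain ⟨i, hi, rfl⟩ := (hv u).1 h2
      have him : i ≤ m := not_lt.1 fun h3 => hdv i h3 hi h1
      exact ⟨⟨i, by omega⟩, by rw [hAv, hd₁ i him]⟩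
    · rintro ⟨t, rfl⟩
      have ht := t.2
      rw [hAv]
      refine ⟨hl.mem_vert _, (hv _).2 ⟨t, by omega, hd₁ _ (by omega)⟩⟩

/-- The inner vertices of an arc have degree two in the union of a cycle and an ear, hence a
leafless edge set avoiding the first edge of the arc avoids the whole arc. -/
theorem notMem_of_leafless (h : IsEar C v m k q) {X : Set E} (hX : D.Leafless X)
    (hXC : ∀ x ∈ X, x ∈ Set.range C.edge ∨ ∃ i < k, D.ends x = s(q i, q (i + 1)))
    (h0 : ∀ x ∈ X, D.ends x ≠ s(v 0, v 1)) :
    ∀ i < m, ∀ x ∈ X, D.ends x ≠ s(v i, v (i + 1)) := by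
  have hl := h.label
  have hmn := h.m_lt
  intro i
  induction i with
  | zero => exact fun _ => h0
  | succ i ih =>
    intro hi x hx hxi
    obtain ⟨y, hy, hyi⟩ := hl.exists_prev hX hx hxi (by
      intro y hy hiy
      refine (hXC y hy).resolve_right ?_
      rintro ⟨t, ht, hyt⟩
      have key : ∀ t ≤ k, v (i + 1) ≠ q t := by
        intro t ht hit
        rcases Nat.eq_zero_or_pos t with rfl | h1
        · rw [h.start] at hit
          have := hl.eq_of_lt (by omega) (by omega) hit
          omega
        · rcases ht.eq_or_lt with rfl | h2
          · rw [h.finish] at hit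
            have := hl.eq_of_lt (by omega) (by omega) hit
            omega
          · exact h.notMem t h1 h2 (hit ▸ hl.mem_vert _)
      rw [hyt, Sym2.mem_iff] at hiy
      rcases hiy with h1 | h1
      · exact key t ht.le h1
      · exact key (t + 1) ht h1)
    exact ih (by omega) y hy hyi

end IsEar

/-- If a cycle meets `C` in an edge but is not contained in `C`, then it contains an ear of
`C`. -/
theorem exists_isEar (C C' : CycleIn D) {f g : E} (hf : f ∈ Set.range C.edge)
    (hf' : f ∈ Set.range C'.edge) (hg : g ∉ Set.range C.edge) (hg' : g ∈ Set.range C'.edge) :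
    ∃ (v : ℕ → V) (m k : ℕ) (q : ℕ → V), IsEar C v m k q ∧
      ∀ e, (∃ i < k, D.ends e = s(q i, q (i + 1))) → e ∈ Set.range C'.edge := by
  classical
  have hn' := C'.hn
  obtain ⟨c, hc⟩ := C'.exists_isLabel
  obtain ⟨i₀, hi₀⟩ := hc.exists_index f hf'
  have hc₀ := hc.shift i₀
  obtain ⟨j₀, hj₀⟩ := hc₀.exists_index g hg'
  obtain ⟨t, ⟨a, ha, hat⟩, hbt⟩ : ∃ t,
      (∃ e ∈ Set.range C.edge, D.ends e = s(c (t + i₀), c (t + 1 + i₀))) ∧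
      ¬ ∃ e ∈ Set.range C.edge, D.ends e = s(c (t + 1 + i₀), c (t + 1 + 1 + i₀)) := by
    by_contra! hcon
    have : ∀ t, ∃ e ∈ Set.range C.edge, D.ends e = s(c (t + i₀), c (t + 1 + i₀)) := by
      intro t
      induction t with
      | zero => exact ⟨f, hf, by rw [hi₀, Nat.zero_add, Nat.zero_add, Nat.add_comm 1]⟩
      | succ t ih => exact hcon t ih
    obtain ⟨e, he, hej⟩ := this j₀
    exact hg (by rwa [D.ends_injective (hj₀.trans hej.symm)])
  set q : ℕ → V := fun i => c (i + (t + 1 + i₀)) with hq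
  have hlq : C'.IsLabel q := hc.shift _
  have hq0 : q 0 ∈ Set.range C.vert := C.mem_vert_of_mem_ends ha (by simp [hat, hq])
  have hqlast : q (C'.n - 1) ∈ Set.range C.vert := by
    have : q (C'.n - 1) = c (t + i₀) := by
      rw [hq]
      change c _ = _
      rw [show C'.n - 1 + (t + 1 + i₀) = t + i₀ + C'.n by omega]
      exact hc.per _
    rw [this]
    exact C.mem_vert_of_mem_ends ha (by simp [hat])
  have hex : ∃ k, 0 < k ∧ q k ∈ Set.range C.vert := ⟨C'.n - 1, by omega, hqlast⟩
  obtain ⟨hk, hqk⟩ := Nat.find_spec hex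
  have hkn : Nat.find hex ≤ C'.n - 1 := Nat.find_min' hex ⟨by omega, hqlast⟩
  have hmin : ∀ i, 0 < i → i < Nat.find hex → q i ∉ Set.range C.vert :=
    fun i h1 h2 h3 => Nat.find_min hex h2 ⟨h1, h3⟩
  obtain ⟨v₀, hv₀⟩ := C.exists_isLabel
  obtain ⟨s₀, hs₀⟩ := hv₀.exists_vert _ hq0
  have hv := hv₀.shift s₀
  obtain ⟨m, hm, hvm⟩ := hv.exists_vert_lt hqk
  refine ⟨fun i => v₀ (i + s₀), m, Nat.find hex, q, ⟨hv, ?_, hm, hk, ?_, ?_, hvm.symm, hmin, ?_⟩,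
    ?_⟩
  · refine Nat.pos_of_ne_zero ?_
    rintro rfl
    rw [Nat.zero_add, hs₀] at hvm
    have := hlq.eq_of_lt (by omega) (by omega) hvm
    omega
  · intro i hi j hj hij
    exact hlq.eq_of_lt (by omega) (by omega) hij
  · simp [hs₀]
  · intro i hi
    obtain ⟨e, -, he⟩ := hlq.exists_edge i
    refine ⟨e, fun heC => ?_, he⟩
    rcases Nat.eq_zero_or_pos i with rfl | h1
    · refine hbt ⟨e, heC, ?_⟩
      simp only [hq, Nat.zero_add] at he
      rw [he, show t + 1 + 1 + i₀ = 1 + (t + 1 + i₀) by omega]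
    · exact hmin i h1 hi (C.mem_vert_of_mem_ends heC (by simp [he]))
  · rintro e ⟨i, -, he⟩
    exact hlq.mem_edge he

/-- A cycle `C'` meeting a cycle `C` in an edge but not contained in it gives rise to a theta
graph: the cycle `C` is split by an ear `Q ⊆ C'` into two arcs, each of which closes up with `Q`
to a cycle. -/
theorem exists_theta (C C' : CycleIn D) {f g : E} (hf : f ∈ Set.range C.edge)
    (hf' : f ∈ Set.range C'.edge) (hg : g ∉ Set.range C.edge) (hg' : g ∈ Set.range C'.edge) :
    ∃ (C₁ C₂ : CycleIn D) (A B : PathIn D) (Q : Set E), SharePath C C₁ A ∧ SharePath C C₂ B ∧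
      Set.range C₁.edge = Set.range A.edge ∪ Q ∧ Set.range C₂.edge = Set.range B.edge ∪ Q ∧
      Set.range C.edge = Set.range A.edge ∪ Set.range B.edge ∧ Q ⊆ Set.range C'.edge ∧
      Q.Nonempty ∧ Disjoint Q (Set.range C.edge) ∧
      ∃ a ∈ Set.range A.edge, a ∉ Set.range B.edge ∧ ∀ X, D.Leafless X →
        X ⊆ Set.range C.edge ∪ Q → a ∉ X → Disjoint X (Set.range A.edge) := by
  obtain ⟨v, m, k, q, h, hQ⟩ := exists_isEar C C' hf hf' hg hg'
  obtain ⟨C₁, A, hs₁, hA, hC₁⟩ := h.exists_sharePath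
  obtain ⟨C₂, B, hs₂, hB, hC₂⟩ := h.symm.exists_sharePath
  have hl := h.label
  have hm := h.m_pos
  have hmn := h.m_lt
  have hk := h.k_pos
  obtain ⟨a, -, ha⟩ := hl.exists_edge 0
  refine ⟨C₁, C₂, A, B, {e | ∃ i < k, D.ends e = s(q i, q (i + 1))}, hs₁, hs₂, Set.ext hC₁,
    ?_, ?_, hQ, ?_, ?_, a, (hA a).2 ⟨0, hm, ha⟩, ?_, ?_⟩
  · ext e
    rw [hC₂]
    refine or_congr Iff.rfl ⟨?_, ?_⟩
    · rintro ⟨i, hi, he⟩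
      refine ⟨k - (i + 1), by omega, ?_⟩
      rw [he, Sym2.eq_swap, show k - (i + 1) + 1 = k - i by omega]
    · rintro ⟨i, hi, he⟩
      refine ⟨k - (i + 1), by omega, ?_⟩
      rw [he, Sym2.eq_swap, show k - (k - (i + 1) + 1) = i by omega,
        show k - (k - (i + 1)) = i + 1 by omega]
  · refine Set.Subset.antisymm (fun e he => ?_) (Set.union_subset hs₁.1 hs₂.1)
    obtain ⟨i, hi, hei⟩ := hl.exists_index_lt he
    rcases Nat.lt_or_ge i m with h1 | h1
    · exact Or.inl ((hA e).2 ⟨i, h1, hei⟩)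
    · refine Or.inr ((hB e).2 ⟨i - m, by omega, ?_⟩)
      rw [hei, show i - m + 1 + m = i + 1 by omega, show i - m + m = i by omega]
  · obtain ⟨e, -, he⟩ := h.adj 0 hk
    exact ⟨e, 0, hk, he⟩
  · rw [Set.disjoint_left]
    rintro e ⟨i, hi, he⟩
    exact h.notMem_edge hi he
  · intro haB
    obtain ⟨i, hi, hai⟩ := (hB a).1 haB
    rw [ha, Sym2.eq_iff] at hai
    have hn := C.hn
    have hper : v C.n = v 0 := by simpa using hl.per 0
    rcases hai with h1 | h1
    · have := hl.eq_of_lt (by omega) (by omega) h1.1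
      omega
    · have h2 := hl.eq_of_lt (by omega) (by omega) h1.2
      rw [show i + 1 + m = 2 by omega] at h1
      have := hl.eq_of_lt (i := 0) (j := 2) (by omega) (by omega) h1.1
      omega
  · intro X hX hXC haX
    have := h.notMem_of_leafless hX hXC (fun x hx hxe => haX (by
      rwa [D.ends_injective (ha.trans hxe.symm)]))
    rw [Set.disjoint_left]
    intro x hx hxA
    obtain ⟨i, hi, hxi⟩ := (hA x).1 hxA
    exact this i hi x hx hxi

end WOGraph

namespace WOGraph

variable {V E : Type*} {D : WOGraph V E}

theorem ConnectedByPath.edge_ne {C₁ C₂ : CycleIn D} {P : PathIn D} (h : ConnectedByPath C₁ C₂ P) :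
    Set.range C₁.edge ≠ Set.range C₂.edge := by
  intro heq
  obtain ⟨e, he⟩ := C₁.edge_nonempty
  have hmem : D.src e ∈ D.ends e := by simp [ends]
  have : D.src e ∈ Set.range C₁.vert ∩ Set.range C₂.vert :=
    ⟨C₁.mem_vert_of_mem_ends he hmem, C₂.mem_vert_of_mem_ends (heq ▸ he) hmem⟩
  rw [h.1] at this
  exact this

theorem CycleIn.edge_eq_of_subset {C C' : CycleIn D}
    (h : Set.range C'.edge ⊆ Set.range C.edge) : Set.range C'.edge = Set.range C.edge :=
  h.antisymm (C.edge_subset_of_leafless C'.leafless h C'.edge_nonempty)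

variable [DecidableEq V]

/-- If there are at most two unbalanced cycles, then two given ones are all of them. -/
theorem edge_eq_or_edge_eq
    (h2 : ∃ S₁ S₂ : Set E, ∀ C : CycleIn D, C.IsUnbalanced →
      Set.range C.edge = S₁ ∨ Set.range C.edge = S₂)
    {U₁ U₂ C : CycleIn D} (h₁ : U₁.IsUnbalanced) (h₂ : U₂.IsUnbalanced)
    (hne : Set.range U₁.edge ≠ Set.range U₂.edge) (hC : C.IsUnbalanced) :
    Set.range C.edge = Set.range U₁.edge ∨ Set.range C.edge = Set.range U₂.edge := by
  obtain ⟨S₁, S₂, h⟩ := h2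
  rcases h U₁ h₁ with h3 | h3 <;> rcases h U₂ h₂ with h4 | h4 <;> rcases h C hC with h5 | h5 <;>
    simp_all

/-- A balanced cycle sharing an edge with a different cycle is covered by the two unbalanced
cycles. -/
theorem CycleIn.IsBalanced.edge_subset_union
    (h2 : ∃ S₁ S₂ : Set E, ∀ C : CycleIn D, C.IsUnbalanced →
      Set.range C.edge = S₁ ∨ Set.range C.edge = S₂)
    (hii : ∀ C₁ C₂ : CycleIn D, C₁.IsBalanced → C₂.IsBalanced →
      ∀ P : PathIn D, ¬ SharePath C₁ C₂ P)
    {C C' U₁ U₂ : CycleIn D} (hC : C.IsBalanced) {f : E} (hf : f ∈ Set.range C.edge)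
    (hf' : f ∈ Set.range C'.edge) (hne : Set.range C'.edge ≠ Set.range C.edge)
    (h₁ : U₁.IsUnbalanced) (h₂ : U₂.IsUnbalanced)
    (hU : Set.range U₁.edge ≠ Set.range U₂.edge) :
    Set.range C.edge ⊆ Set.range U₁.edge ∪ Set.range U₂.edge := by
  obtain ⟨g, hg', hg⟩ := Set.not_subset.1 (mt CycleIn.edge_eq_of_subset hne)
  obtain ⟨C₁, C₂, A, B, Q, hs₁, hs₂, -, -, hAB, -⟩ := exists_theta C C' hf hf' hg hg'
  have hC₁ : C₁.IsUnbalanced := fun h => hii C C₁ hC h A hs₁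
  have hC₂ : C₂.IsUnbalanced := fun h => hii C C₂ hC h B hs₂
  have key : ∀ C₀ : CycleIn D, C₀.IsUnbalanced →
      Set.range C₀.edge ⊆ Set.range U₁.edge ∪ Set.range U₂.edge := by
    intro C₀ h₀
    rcases edge_eq_or_edge_eq h2 h₁ h₂ hU h₀ with h | h
    · exact h ▸ Set.subset_union_left
    · exact h ▸ Set.subset_union_right
  rw [hAB]
  exact Set.union_subset (hs₁.2.1.trans (key C₁ hC₁)) (hs₂.2.1.trans (key C₂ hC₂))

variable [Fintype E]

/-- Two balanced cycles sharing an edge have the same edges. -/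
theorem CycleIn.IsBalanced.edge_eq_of_mem
    (h2 : ∃ S₁ S₂ : Set E, ∀ C : CycleIn D, C.IsUnbalanced →
      Set.range C.edge = S₁ ∨ Set.range C.edge = S₂)
    (hii : ∀ C₁ C₂ : CycleIn D, C₁.IsBalanced → C₂.IsBalanced →
      ∀ P : PathIn D, ¬ SharePath C₁ C₂ P)
    {C C' : CycleIn D} (hC : C.IsBalanced) (hC' : C'.IsBalanced) {f : E}
    (hf : f ∈ Set.range C.edge) (hf' : f ∈ Set.range C'.edge) :
    Set.range C'.edge = Set.range C.edge := by
  by_contra hne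
  obtain ⟨g, hg', hg⟩ := Set.not_subset.1 (mt CycleIn.edge_eq_of_subset hne)
  obtain ⟨C₁, C₂, A, B, Q, hs₁, hs₂, hC₁e, hC₂e, hAB, hQ, ⟨x, hx⟩, hQC, a, haA, haB, hprop⟩ :=
    exists_theta C C' hf hf' hg hg'
  have hC₁ : C₁.IsUnbalanced := fun h => hii C C₁ hC h A hs₁
  have hC₂ : C₂.IsUnbalanced := fun h => hii C C₂ hC h B hs₂
  have haC : a ∈ Set.range C.edge := hs₁.1 haA
  have hne₁₂ : Set.range C₁.edge ≠ Set.range C₂.edge := by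
    intro h
    have : a ∈ Set.range C₂.edge := h ▸ hs₁.2.1 haA
    rw [hC₂e] at this
    exact this.elim haB fun haQ => Set.disjoint_left.1 hQC haQ haC
  have hC'sub : Set.range C'.edge ⊆ Set.range C.edge ∪ Q := by
    refine (hC'.edge_subset_union h2 hii hf' hf (Ne.symm hne) hC₁ hC₂ hne₁₂).trans ?_
    rw [hC₁e, hC₂e, hAB]
    intro y hy
    simp only [Set.mem_union] at hy ⊢
    tauto
  obtain ⟨y, hy, hys⟩ := hC.exists_vsupp_eq
  obtain ⟨y', hy', hys'⟩ := hC'.exists_vsupp_eq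
  have hya : y a ≠ 0 := show a ∈ vsupp y from hys ▸ haC
  set z : E → ℤ := y a • y' - y' a • y with hz
  have hzker : z ∈ D.kerLattice :=
    sub_mem (Submodule.smul_mem _ _ hy') (Submodule.smul_mem _ _ hy)
  have hzsub : vsupp z ⊆ Set.range C.edge ∪ Q := by
    intro e he
    by_contra hcon
    have h3 : y e = 0 := by
      by_contra h
      exact hcon (Or.inl (hys ▸ h))
    have h4 : y' e = 0 := by
      by_contra h
      exact hcon (hC'sub (hys' ▸ h))
    exact he (by simp [hz, h3, h4])
  have hdis := hprop _ (leafless_vsupp hzker) hzsub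
    (fun h => h (by simp only [hz, Pi.sub_apply, Pi.smul_apply, smul_eq_mul]; ring))
  refine hC₂ (C₂.isBalanced_iff.2 ⟨z, hzker, ?_, ?_⟩)
  · refine Function.ne_iff.2 ⟨x, ?_⟩
    have h3 : y x = 0 := by
      by_contra h
      exact Set.disjoint_left.1 hQC hx (hys ▸ h)
    have h4 : y' x ≠ 0 := show x ∈ vsupp y' from hys' ▸ hQ hx
    simp [hz, h3, h4, hya]
  · intro e he
    rw [hC₂e]
    have h3 := hzsub he
    rw [hAB] at h3
    rcases h3 with (h3 | h3) | h3
    · exact absurd h3 (Set.disjoint_left.1 hdis he)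
    · exact Or.inl h3
    · exact Or.inr h3

/-- A nonzero kernel vector whose support contains no balanced cycle contains two unbalanced
cycles in its support. -/
theorem exists_unbalanced_pair [Finite V] {z : E → ℤ} (hz : z ∈ D.kerLattice) (hz0 : z ≠ 0)
    (hb : ∀ C : CycleIn D, C.IsBalanced → ¬ Set.range C.edge ⊆ vsupp z) :
    ∃ U₁ U₂ : CycleIn D, U₁.IsUnbalanced ∧ U₂.IsUnbalanced ∧
      Set.range U₁.edge ≠ Set.range U₂.edge ∧ Set.range U₁.edge ⊆ vsupp z ∧
      Set.range U₂.edge ⊆ vsupp z := by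
  have hX := leafless_vsupp hz
  by_contra hcon
  have huniq : ∀ C₁ C₂ : CycleIn D, Set.range C₁.edge ⊆ vsupp z → Set.range C₂.edge ⊆ vsupp z →
      Set.range C₁.edge = Set.range C₂.edge := by
    intro C₁ C₂ h₁ h₂
    by_contra hne
    exact hcon ⟨C₁, C₂, fun h => hb _ h h₁, fun h => hb _ h h₂, hne, h₁, h₂⟩
  have hcyc : ∀ e ∈ vsupp z, ∃ C : CycleIn D, Set.range C.edge ⊆ vsupp z ∧
      e ∈ Set.range C.edge := by
    intro e he
    refine (hX.exists_cycle_or_path he).resolve_right ?_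
    rintro ⟨C₁, C₂, P, h₁, h₂, hP, -⟩
    exact hP.edge_ne (huniq C₁ C₂ h₁ h₂)
  obtain ⟨x, hx⟩ := Function.ne_iff.1 hz0
  obtain ⟨C, hC, -⟩ := hcyc x hx
  refine hb C (C.isBalanced_iff.2 ⟨z, hz, hz0, fun e he => ?_⟩) hC
  obtain ⟨C', hC', he'⟩ := hcyc e he
  exact huniq C' C hC' hC ▸ he'

/-- A kernel vector vanishing on one edge of a balanced cycle vanishes on the whole cycle. -/
theorem CycleIn.IsBalanced.apply_eq_zero [Finite V]
    (h2 : ∃ S₁ S₂ : Set E, ∀ C : CycleIn D, C.IsUnbalanced →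
      Set.range C.edge = S₁ ∨ Set.range C.edge = S₂)
    (hi : ∀ C₁ C₂ : CycleIn D, C₁.IsUnbalanced → C₂.IsUnbalanced →
      ∀ P : PathIn D, ConnectedByPath C₁ C₂ P →
        ∀ C : CycleIn D, C.IsBalanced →
          Set.range C.edge ∩ Set.range P.edge = ∅)
    (hii : ∀ C₁ C₂ : CycleIn D, C₁.IsBalanced → C₂.IsBalanced →
      ∀ P : PathIn D, ¬ SharePath C₁ C₂ P)
    {C : CycleIn D} (hC : C.IsBalanced) {e f : E} (he : e ∈ Set.range C.edge)
    (hf : f ∈ Set.range C.edge) {z : E → ℤ} (hz : z ∈ D.kerLattice) (hze : z e = 0) :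
    z f = 0 := by
  induction hN : (vsupp z).ncard using Nat.strong_induction_on generalizing z with
  | _ N ih =>
  by_contra hzf
  by_cases hb : ∃ C' : CycleIn D, C'.IsBalanced ∧ Set.range C'.edge ⊆ vsupp z
  · obtain ⟨C', hC', hsub⟩ := hb
    have hdis : ∀ x ∈ Set.range C.edge, x ∉ Set.range C'.edge := by
      intro x hx hx'
      have := hC.edge_eq_of_mem h2 hii hC' hx hx'
      exact hsub (this ▸ he) hze
    obtain ⟨y, hy, hys⟩ := hC'.exists_vsupp_eq
    have hy0 : ∀ x ∈ Set.range C.edge, y x = 0 := by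
      intro x hx
      by_contra h
      exact hdis x hx (hys ▸ h)
    obtain ⟨e', he'⟩ := C'.edge_nonempty
    have hye' : y e' ≠ 0 := show e' ∈ vsupp y from hys ▸ he'
    have := ih _ ?_ (z := y e' • z - z e' • y)
      (sub_mem (Submodule.smul_mem _ _ hz) (Submodule.smul_mem _ _ hy))
      (by simp [hze, hy0 e he]) rfl
    · simp [hy0 f hf, hye', hzf] at this
    · rw [← hN]
      refine Set.ncard_lt_ncard (Set.ssubset_iff_exists.2 ⟨fun x hx => ?_, e', hsub he', ?_⟩)
      · by_contra hzx
        have hyx : y x = 0 := by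
          by_contra h
          exact hzx (hsub (hys ▸ h))
        have hzx' : z x = 0 := not_not.1 hzx
        exact hx (by simp [hyx, hzx'])
      · simp only [vsupp, Set.mem_ofPred_eq, not_not, Pi.sub_apply, Pi.smul_apply, smul_eq_mul]
        ring
  · have hb' : ∀ C' : CycleIn D, C'.IsBalanced → ¬ Set.range C'.edge ⊆ vsupp z :=
      fun C' h h' => hb ⟨C', h, h'⟩
    obtain ⟨U₁, U₂, h₁, h₂, hne, hs₁, hs₂⟩ :=
      exists_unbalanced_pair hz (fun h => hzf (by simp [h])) hb'
    rcases (leafless_vsupp hz).exists_cycle_or_path hzf with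
      ⟨C', hC', hf'⟩ | ⟨C₁, C₂, P, hC₁, hC₂, hP, hfP⟩
    · have hne' : Set.range C'.edge ≠ Set.range C.edge := fun h => hC' (h ▸ he) hze
      exact (hC.edge_subset_union h2 hii hf hf' hne' h₁ h₂ hne).trans
        (Set.union_subset hs₁ hs₂) he hze
    · have := hi C₁ C₂ (fun h => hb' _ h hC₁) (fun h => hb' _ h hC₂) P hP C hC
      exact (this ▸ (⟨hf, hfP⟩ : f ∈ Set.range C.edge ∩ Set.range P.edge) : f ∈ (∅ : Set E))

end WOGraph

section Primitive

open WOGraph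

variable {V E : Type*} [DecidableEq V] [Fintype E] {D : WOGraph V E} {K : Type*} [Field K]

theorem IsPrimitiveIn.mem_kerLattice {b : E → ℤ} (hb : IsPrimitiveIn K (D.toricIdeal K) b) :
    b ∈ D.kerLattice :=
  (D.binom_mem_toricIdeal K b).1 hb.2.1

theorem toNat_le_toNat_of_le_or_nonpos {x y : ℤ} (h : x ≤ y ∨ x ≤ 0) : x.toNat ≤ y.toNat := by
  lia

/-- A primitive vector which is an integral multiple of a lattice vector is this vector up to
sign. -/
theorem IsPrimitiveIn.eq_or_eq_neg_of_eq_smul {b d : E → ℤ}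
    (hb : IsPrimitiveIn K (D.toricIdeal K) b) (hd : d ∈ D.kerLattice) {a : ℤ} (h : b = a • d) :
    b = d ∨ b = -d := by
  have hd0 : d ≠ 0 := by
    rintro rfl
    exact hb.1 (by rw [h, smul_zero])
  have happ : ∀ e, b e = a * d e := fun e => by rw [h]; rfl
  rcases lt_trichotomy a 0 with ha | rfl | ha
  · right
    refine (hb.eq_of_conformal (neg_ne_zero.2 hd0)
      ((D.binom_mem_toricIdeal K _).2 (neg_mem hd)) (fun e => ?_) fun e => ?_).symm <;>
    · refine toNat_le_toNat_of_le_or_nonpos ?_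
      rw [happ, Pi.neg_apply]
      rcases le_total (d e) 0 with h1 | h1
      · first | (left; nlinarith) | (right; linarith)
      · first | (right; linarith) | (left; nlinarith)
  · exact absurd (by rw [h, zero_smul]) hb.1
  · left
    refine (hb.eq_of_conformal hd0 ((D.binom_mem_toricIdeal K _).2 hd) (fun e => ?_)
      fun e => ?_).symm <;>
    · refine toNat_le_toNat_of_le_or_nonpos ?_
      rw [happ]
      rcases le_total (d e) 0 with h1 | h1
      · first | (left; nlinarith) | (right; linarith)
      · first | (right; linarith) | (left; nlinarith)

/-- Proportional primitive vectors agree up to sign. -/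
theorem IsPrimitiveIn.eq_or_eq_neg {b c : E → ℤ} (hb : IsPrimitiveIn K (D.toricIdeal K) b)
    (hc : IsPrimitiveIn K (D.toricIdeal K) c) {p q : ℤ} (hp : p ≠ 0) (h : p • b = q • c) :
    b = c ∨ b = -c := by
  obtain ⟨g, p', q', hg, hcop, rfl, rfl⟩ := Int.exists_gcd_one' (Int.gcd_pos_of_ne_zero_left q hp)
  have hg' : (g : ℤ) ≠ 0 := by exact_mod_cast hg.ne'
  have happ : ∀ e, p' * b e = q' * c e := by
    intro e
    have := congrFun h e
    simp only [Pi.smul_apply, smul_eq_mul] at this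
    refine mul_left_cancel₀ hg' ?_
    linarith
  have hcop' : IsCoprime p' q' := Int.isCoprime_iff_gcd_eq_one.2 hcop
  have hp' : p' ≠ 0 := left_ne_zero_of_mul hp
  have hdvd : ∀ e, p' ∣ c e := fun e => hcop'.dvd_of_dvd_mul_left ⟨b e, (happ e).symm⟩
  choose d hd using hdvd
  have hcd : c = p' • d := funext hd
  have hbd : b = q' • d := by
    funext e
    refine mul_left_cancel₀ hp' ?_
    rw [happ, hd, Pi.smul_apply, smul_eq_mul]
    ring
  have hdker : d ∈ D.kerLattice := mem_kerLattice_of_smul hp' (hcd ▸ hc.mem_kerLattice)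
  rcases hb.eq_or_eq_neg_of_eq_smul hdker hbd with h1 | h1 <;>
    rcases hc.eq_or_eq_neg_of_eq_smul hdker hcd with h3 | h3 <;> simp [h1, h3]

/-- A primitive vector whose restriction to `S` is a nonzero lattice vector is supported on
`S`. -/
theorem IsPrimitiveIn.vsupp_subset {b : E → ℤ} (hb : IsPrimitiveIn K (D.toricIdeal K) b)
    {S : Set E} {e : E} (he : b e ≠ 0) (heS : e ∈ S)
    (hS : S.indicator b ∈ D.kerLattice) : vsupp b ⊆ S := by
  have h0 : S.indicator b ≠ 0 :=
    Function.ne_iff.2 ⟨e, by rwa [Set.indicator_of_mem heS]⟩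
  have := hb.eq_of_conformal h0 ((D.binom_mem_toricIdeal K _).2 hS)
    (fun i => by by_cases h : i ∈ S <;> simp [h]) (fun i => by by_cases h : i ∈ S <;> simp [h])
  intro x hx
  by_contra h
  exact hx (by rw [← this, Set.indicator_of_notMem h])

end Primitive

namespace WOGraph

variable {V E : Type*} [DecidableEq V] [Fintype E] {D : WOGraph V E}

theorem primitive_eq_or_eq_neg [Finite V] {K : Type*} [Field K]
    (h2 : ∃ S₁ S₂ : Set E, ∀ C : CycleIn D, C.IsUnbalanced →
      Set.range C.edge = S₁ ∨ Set.range C.edge = S₂)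
    (hi : ∀ C₁ C₂ : CycleIn D, C₁.IsUnbalanced → C₂.IsUnbalanced →
      ∀ P : PathIn D, ConnectedByPath C₁ C₂ P →
        ∀ C : CycleIn D, C.IsBalanced →
          Set.range C.edge ∩ Set.range P.edge = ∅)
    (hii : ∀ C₁ C₂ : CycleIn D, C₁.IsBalanced → C₂.IsBalanced →
      ∀ P : PathIn D, ¬ SharePath C₁ C₂ P)
    {b c : E → ℤ} (hb : IsPrimitiveIn K (D.toricIdeal K) b)
    (hc : IsPrimitiveIn K (D.toricIdeal K) c) {e : E} (hbe : b e ≠ 0) (hce : c e ≠ 0) :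
    b = c ∨ b = -c := by
  have hprop : ∀ {C : CycleIn D}, C.IsBalanced → ∀ {e : E}, e ∈ Set.range C.edge →
      ∀ {b : E → ℤ}, IsPrimitiveIn K (D.toricIdeal K) b → b e ≠ 0 → ∀ {y : E → ℤ},
      y ∈ D.kerLattice → vsupp y = Set.range C.edge →
      vsupp b ⊆ Set.range C.edge ∧ y e • b = b e • y := by
    intro C hC e he b hb hbe y hy hys
    have hye : y e ≠ 0 := show e ∈ vsupp y from hys ▸ he
    have hz : ∀ f ∈ Set.range C.edge, y e * b f = b e * y f := by
      intro f hf
      have := hC.apply_eq_zero h2 hi hii he hf (z := y e • b - b e • y)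
        (sub_mem (Submodule.smul_mem _ _ hb.mem_kerLattice) (Submodule.smul_mem _ _ hy))
        (by simp only [Pi.sub_apply, Pi.smul_apply, smul_eq_mul]; ring)
      simpa [sub_eq_zero] using this
    have hy0 : ∀ f, f ∉ Set.range C.edge → y f = 0 := by
      intro f hf
      by_contra h
      exact hf (hys ▸ h)
    have hsub : vsupp b ⊆ Set.range C.edge := by
      refine hb.vsupp_subset hbe he (mem_kerLattice_of_smul hye ?_)
      have : y e • (Set.range C.edge).indicator b = b e • y := by
        funext f
        by_cases hf : f ∈ Set.range C.edge
        · simp only [Pi.smul_apply, Set.indicator_of_mem hf, smul_eq_mul, hz f hf]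
        · simp only [Pi.smul_apply, Set.indicator_of_notMem hf, smul_eq_mul, hy0 f hf, mul_zero]
      rw [this]
      exact Submodule.smul_mem _ _ hy
    refine ⟨hsub, funext fun f => ?_⟩
    by_cases hf : f ∈ Set.range C.edge
    · exact hz f hf
    · have : b f = 0 := by
        by_contra h
        exact hf (hsub h)
      simp [this, hy0 f hf]
  by_cases hex : ∃ C : CycleIn D, C.IsBalanced ∧ e ∈ Set.range C.edge
  · obtain ⟨C, hC, he⟩ := hex
    obtain ⟨y, hy, hys⟩ := hC.exists_vsupp_eq
    have hye : y e ≠ 0 := show e ∈ vsupp y from hys ▸ he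
    have h1 := (hprop hC he hb hbe hy hys).2
    have h3 := (hprop hC he hc hce hy hys).2
    refine hb.eq_or_eq_neg hc (mul_ne_zero hce hye) (q := b e * y e) ?_
    rw [mul_smul, h1, mul_smul, h3, smul_comm]
  · have hoff : ∀ {b : E → ℤ}, IsPrimitiveIn K (D.toricIdeal K) b → b e ≠ 0 →
        ∀ C : CycleIn D, C.IsBalanced → ∀ f ∈ Set.range C.edge, b f = 0 := by
      intro b hb hbe C hC f hf
      by_contra hbf
      obtain ⟨y, hy, hys⟩ := hC.exists_vsupp_eq
      exact hex ⟨C, hC, (hprop hC hf hb hbf hy hys).1 hbe⟩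
    have hno : ∀ z : E → ℤ, (∀ C : CycleIn D, C.IsBalanced → ∀ f ∈ Set.range C.edge, z f = 0) →
        ∀ C : CycleIn D, C.IsBalanced → ¬ Set.range C.edge ⊆ vsupp z := by
      intro z hz C hC hsub
      obtain ⟨f, hf⟩ := C.edge_nonempty
      exact hsub hf (hz C hC f hf)
    obtain ⟨U₁, U₂, h₁, h₂, hne, hs₁, -⟩ :=
      exists_unbalanced_pair hb.mem_kerLattice hb.1 (hno b (hoff hb hbe))
    have hmem : ∀ z ∈ D.kerLattice, z ≠ 0 →
        (∀ C : CycleIn D, C.IsBalanced → ∀ f ∈ Set.range C.edge, z f = 0) →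
        Set.range U₁.edge ⊆ vsupp z := by
      intro z hz hz0 hzoff
      obtain ⟨W₁, W₂, h₁', h₂', hne', hs₁', hs₂'⟩ := exists_unbalanced_pair hz hz0 (hno z hzoff)
      rcases edge_eq_or_edge_eq h2 h₁' h₂' hne' h₁ with h | h
      · exact h ▸ hs₁'
      · exact h ▸ hs₂'
    obtain ⟨x, hx⟩ := U₁.edge_nonempty
    have hcx : c x ≠ 0 := hmem c hc.mem_kerLattice hc.1 (hoff hc hce) hx
    refine hb.eq_or_eq_neg hc hcx (q := b x) ?_
    by_contra hne0
    refine hmem (c x • b - b x • c)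
      (sub_mem (Submodule.smul_mem _ _ hb.mem_kerLattice)
        (Submodule.smul_mem _ _ hc.mem_kerLattice)) (sub_ne_zero.2 hne0) ?_ hx ?_
    · intro C hC f hf
      simp [hoff hb hbe C hC f hf, hoff hc hce C hC f hf]
    · simp only [Pi.sub_apply, Pi.smul_apply, smul_eq_mul]
      ring

end WOGraph

theorem binom_neg (K : Type*) [Field K] {ι : Type*} [Fintype ι] (b : ι → ℤ) :
    binom K (-b) = -binom K b := by
  simp [binom, binomPlus, binomMinus]

open WOGraph in
/-- from the proof of Theorem 3.5. Under the hypotheses of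
Theorem 3.5, any two elements of the Graver basis `Gr_D` which are distinct as
binomials (i.e. neither equal nor negatives of each other) have disjoint
supports. -/
theorem stmt17 {V E : Type*} [Fintype V] [Fintype E] [DecidableEq V]
    (K : Type*) [Field K] (D : WOGraph V E)
    (h2 : ∃ S₁ S₂ : Set E, ∀ C : CycleIn D, C.IsUnbalanced →
      Set.range C.edge = S₁ ∨ Set.range C.edge = S₂)
    (hi : ∀ C₁ C₂ : CycleIn D, C₁.IsUnbalanced → C₂.IsUnbalanced →
      ∀ P : PathIn D, ConnectedByPath C₁ C₂ P →
        ∀ C : CycleIn D, C.IsBalanced →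
          Set.range C.edge ∩ Set.range P.edge = ∅)
    (hii : ∀ C₁ C₂ : CycleIn D, C₁.IsBalanced → C₂.IsBalanced →
      ∀ P : PathIn D, ¬ SharePath C₁ C₂ P) :
    ∀ f ∈ D.graverSet K, ∀ g ∈ D.graverSet K, f ≠ g → f ≠ -g →
      Disjoint (MvPolynomial.vars f) (MvPolynomial.vars g) := by
  rintro _ ⟨b, rfl, hb⟩ _ ⟨c, rfl, hc⟩ hne hne'
  rw [Finset.disjoint_left]
  intro e hbe hce
  rcases primitive_eq_or_eq_neg h2 hi hii hb hc (vars_binom_subset K b hbe)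
      (vars_binom_subset K c hce) with rfl | rfl
  · exact hne rfl
  · exact hne' (binom_neg K c)
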